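/- arXiv:math/0304023 — 2 statements merged into one kernel-verified Lean document; each statement's English description precedes it below -/
import Mathlib

section
/- Let A be a seminormed commutative ring that is separable, i.e. admits a countable dense subset. Let M(A) denote the set of all bounded multiplicative seminorms on A, regarded as a subset of the space of functions A → ℝ equipped with the topology of pointwise convergence (the product topology). Then M(A) is a compact metrizable topological space. -/
open TopologicalSpace

/-- A subadditive function bounded by the norm is `1`-Lipschitz. -/
theorem lipschitzWith_one_of_subadditive_of_le_norm {A : Type*} [SeminormedAddCommGroup A]
    {φ : A → ℝ} (le_norm : ∀ a, φ a ≤ ‖a‖) (add_le : ∀ a b, φ (a + b) ≤ φ a + φ b) :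
    LipschitzWith 1 φ := by
  refine LipschitzWith.of_le_add fun a b => ?_
  have h := add_le b (a - b)
  rw [add_sub_cancel] at h
  rw [dist_eq_norm]
  linarith [le_norm (a - b)]

/-- The Berkovich spectrum (set of bounded multiplicative seminorms) of a separable
seminormed commutative ring, with the topology of pointwise convergence, is a compact
metrizable topological space. -/
theorem berkovich_spectrum_compact_metrizable
    (A : Type*) [SeminormedCommRing A] [SeparableSpace A]
    (M : Set (A → ℝ))
    (hM : M = {φ : A → ℝ |
      (∀ a, 0 ≤ φ a) ∧ (∀ a, φ a ≤ ‖a‖) ∧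
      (∀ a b, φ (a + b) ≤ φ a + φ b) ∧
      (∀ a b, φ (a * b) = φ a * φ b) ∧ φ 1 = 1}) :
    CompactSpace M ∧ MetrizableSpace M := by
  have hclosed : IsClosed M := by
    rw [hM]
    simp only [Set.ofPred_and, Set.ofPred_forall]
    refine IsClosed.inter ?_ (IsClosed.inter ?_ (IsClosed.inter ?_ (IsClosed.inter ?_ ?_)))
    · exact isClosed_iInter fun a => isClosed_le (by fun_prop) (by fun_prop)
    · exact isClosed_iInter fun a => isClosed_le (by fun_prop) (by fun_prop)
    · exact isClosed_iInter fun a => isClosed_iInter fun b =>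
        isClosed_le (by fun_prop) (by fun_prop)
    · exact isClosed_iInter fun a => isClosed_iInter fun b =>
        isClosed_eq (by fun_prop) (by fun_prop)
    · exact isClosed_eq (by fun_prop) (by fun_prop)
  have hcompact : IsCompact M := by
    have hbox : IsCompact (Set.univ.pi fun a : A => Set.Icc 0 ‖a‖) :=
      isCompact_univ_pi fun _ => isCompact_Icc
    refine hbox.of_isClosed_subset hclosed fun φ hφ a _ => ?_
    rw [hM] at hφ
    exact ⟨hφ.1 a, hφ.2.1 a⟩
  have hcont : ∀ φ ∈ M, Continuous φ := by
    intro φ hφ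
    rw [hM] at hφ
    obtain ⟨-, le_norm, add_le, -⟩ := hφ
    exact (lipschitzWith_one_of_subadditive_of_le_norm le_norm add_le).continuous
  have : CompactSpace M := isCompact_iff_compactSpace.mp hcompact
  refine ⟨this, ?_⟩
  let restrict : M → ℕ → ℝ := fun φ n => φ.1 (denseSeq A n)
  have hrestrict : Continuous restrict :=
    continuous_pi fun n => (continuous_apply (denseSeq A n)).comp continuous_subtype_val
  have hinj : Function.Injective restrict := fun φ ψ h =>
    Subtype.ext <| (denseRange_denseSeq A).equalizer (hcont φ φ.2) (hcont ψ ψ.2) h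
  exact (hrestrict.isClosedEmbedding hinj).isEmbedding.metrizableSpace
end

section
/- Let X be a compact metrizable topological space, (μ_n) a sequence of Borel probability measures on X, ν a Borel probability measure on X, (h_n) a sequence of real numbers converging to h ∈ ℝ, and D a dense subset of the space C(X, ℝ) of continuous real-valued functions with the supremum norm. Suppose that for every f ∈ D there exists C ≥ 0 such that for all t ∈ ℝ: liminf_{n→∞} ( h_n + t · ∫ f dμ_n ) ≥ h + t · ∫ f dν − C · t². Then (μ_n) converges weakly to ν, i.e. ∫ f dμ_n → ∫ f dν for every continuous f : X → ℝ. -/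
open Filter MeasureTheory

/-- One-sided variational principle: a quadratic lower bound on `liminf (uₙ + t aₙ)` for `t > 0`
forces `aₙ` to be eventually at least `a - ε`. -/
lemma eventually_sub_lt_of_le_liminf {u a : ℕ → ℝ} {h b C B : ℝ}
    (hu : Tendsto u atTop (nhds h)) (ha : ∀ n, |a n| ≤ B) (hC : 0 ≤ C)
    (hineq : ∀ t : ℝ, 0 < t →
      h + t * b - C * t ^ 2 ≤ liminf (fun n => u n + t * a n) atTop)
    {ε : ℝ} (hε : 0 < ε) : ∀ᶠ n in atTop, b - ε < a n := by
  obtain ⟨t, ht, hCt⟩ : ∃ t : ℝ, 0 < t ∧ C * t ≤ ε / 4 := by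
    refine ⟨ε / (4 * (C + 1)), by positivity, ?_⟩
    rw [← mul_div_assoc, div_le_div_iff₀ (by positivity) (by norm_num)]
    nlinarith
  have hbdd : IsBoundedUnder (· ≥ ·) atTop (fun n => u n + t * a n) := by
    obtain ⟨m, hm⟩ := hu.bddBelow_range
    refine isBoundedUnder_of ⟨m - t * B, fun n => ?_⟩
    have h₁ : m ≤ u n := hm ⟨n, rfl⟩
    have h₂ : t * (-B) ≤ t * a n := mul_le_mul_of_nonneg_left (neg_le_of_abs_le (ha n)) ht.le
    change m - t * B ≤ u n + t * a n
    linarith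
  have htε : 0 < t * (ε / 4) := by positivity
  have hlt : h + t * b - C * t ^ 2 - t * (ε / 4) < liminf (fun n => u n + t * a n) atTop :=
    (sub_lt_self _ htε).trans_le (hineq t ht)
  filter_upwards [eventually_lt_of_lt_liminf hlt hbdd,
    hu.eventually_lt_const (lt_add_of_pos_right h htε)] with n h₁ h₂
  have h₃ : t * (C * t) ≤ t * (ε / 4) := mul_le_mul_of_nonneg_left hCt ht.le
  refine lt_of_mul_lt_mul_left ?_ ht.le
  nlinarith

/-- Two-sided variational principle: a quadratic lower bound on `liminf (uₙ + t aₙ)` for all real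
`t` forces a bounded sequence `aₙ` to converge to `b`. -/
lemma tendsto_of_le_liminf {u a : ℕ → ℝ} {h b C B : ℝ}
    (hu : Tendsto u atTop (nhds h)) (ha : ∀ n, |a n| ≤ B) (hC : 0 ≤ C)
    (hineq : ∀ t : ℝ, h + t * b - C * t ^ 2 ≤ liminf (fun n => u n + t * a n) atTop) :
    Tendsto a atTop (nhds b) := by
  rw [Metric.tendsto_nhds]
  intro ε hε
  have hneg : ∀ t : ℝ, 0 < t →
      h + t * (-b) - C * t ^ 2 ≤ liminf (fun n => u n + t * (-a n)) atTop := fun t _ => by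
    simpa using hineq (-t)
  filter_upwards [eventually_sub_lt_of_le_liminf hu ha hC (fun t _ => hineq t) hε,
    eventually_sub_lt_of_le_liminf hu (a := fun n => -a n) (by simpa using ha) hC hneg hε]
    with n h₁ h₂
  rw [Real.dist_eq, abs_lt]
  constructor <;> linarith

lemma abs_integral_le_norm {X : Type*} [TopologicalSpace X] [CompactSpace X] [MeasurableSpace X]
    (μ : Measure X) [IsProbabilityMeasure μ] (f : C(X, ℝ)) : |∫ x, f x ∂μ| ≤ ‖f‖ := by
  simpa using norm_integral_le_of_norm_le_const (μ := μ) (Eventually.of_forall f.norm_coe_le_norm)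

lemma dist_integral_le_dist {X : Type*} [TopologicalSpace X] [CompactSpace X]
    [MeasurableSpace X] [BorelSpace X] (μ : Measure X) [IsProbabilityMeasure μ] (f g : C(X, ℝ)) :
    dist (∫ x, f x ∂μ) (∫ x, g x ∂μ) ≤ dist f g := by
  have hint (k : C(X, ℝ)) : Integrable k μ :=
    k.continuous.integrable_of_hasCompactSupport (HasCompactSupport.of_compactSpace k)
  rw [Real.dist_eq, dist_eq_norm, ← integral_sub (hint f) (hint g)]
  exact abs_integral_le_norm μ (f - g)

/-- Abstract Szpiro–Ullmo–Zhang equidistribution skeleton: if `hₙ → h` and for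
every test function `f` in a dense subset of `C(X, ℝ)` there is `C ≥ 0` with
`liminf (hₙ + t ∫ f dμₙ) ≥ h + t ∫ f dν - C t²` for all real `t`, then `μₙ`
converges weakly to `ν`. -/
theorem equidistribution_skeleton
    {X : Type*} [TopologicalSpace X] [CompactSpace X]
    [TopologicalSpace.MetrizableSpace X] [MeasurableSpace X] [BorelSpace X]
    (μ : ℕ → Measure X) (hμ : ∀ n, IsProbabilityMeasure (μ n))
    (ν : Measure X) (hν : IsProbabilityMeasure ν)
    (hn : ℕ → ℝ) (h : ℝ) (hh : Tendsto hn atTop (nhds h))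
    (D : Set C(X, ℝ)) (hD : Dense D)
    (hineq : ∀ f ∈ D, ∃ C : ℝ, 0 ≤ C ∧ ∀ t : ℝ,
      h + t * (∫ x, f x ∂ν) - C * t ^ 2 ≤
        liminf (fun n => hn n + t * ∫ x, f x ∂(μ n)) atTop) :
    ∀ f : X → ℝ, Continuous f →
      Tendsto (fun n => ∫ x, f x ∂(μ n)) atTop (nhds (∫ x, f x ∂ν)) := by
  intro f hf
  lift f to C(X, ℝ) using hf
  rw [Metric.tendsto_nhds]
  intro ε hε
  obtain ⟨g, hgD, hg⟩ := hD.exists_dist_lt f (show 0 < ε / 3 by positivity)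
  obtain ⟨C, hC, hgC⟩ := hineq g hgD
  have hlim := tendsto_of_le_liminf hh (fun n => abs_integral_le_norm (μ n) g) hC hgC
  filter_upwards [Metric.tendsto_nhds.1 hlim (ε / 3) (by positivity)] with n hgn
  have h₁ := dist_integral_le_dist (μ n) f g
  have h₂ := dist_integral_le_dist ν g f
  rw [dist_comm g f] at h₂
  have h₃ := dist_triangle4 (∫ x, f x ∂(μ n)) (∫ x, g x ∂(μ n)) (∫ x, g x ∂ν) (∫ x, f x ∂ν)
  linarith
end
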